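/- Let G be a three-player LTL game (Ag = {1,2,3}) with empty strong core, and let {a,b,c} be a permutation of {1,2,3}. Then there do not exist strategies σ_a, σ'_a for player a, σ_b for player b, and σ_c, σ'_c for player c such that all of the following hold: the run of (σ_a, σ_b, σ_c) satisfies γ_a and γ_b but not γ_c; the run of (σ_a, σ_b, σ'_c) satisfies γ_c only; the run of (σ'_a, σ_b, σ'_c) satisfies γ_a only; σ'_c is a strong beneficial deviation for {c} from (σ_a, σ_b, σ_c); and σ'_a is a strong beneficial deviation for {a} from (σ_a, σ_b, σ'_c). -/

import Mathlib

/-- A concurrent game structure over a set of agents `Ag`, states `St`, and,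
for each agent `i`, a set of actions `Ac i`.  It consists of an initial state
and a transition function. -/
structure CGS (Ag St : Type) (Ac : Ag → Type) where
  init : St
  tr : St → (∀ i, Ac i) → St

/-- A strategy for a player with actions `A`: it maps finite (nonempty)
histories of states, given as lists, to an action. -/
abbrev Strategy (St A : Type) := List St → A

/-- A strategy profile: one strategy for each player. -/
abbrev Profile {Ag : Type} (St : Type) (Ac : Ag → Type) := ∀ i, Strategy St (Ac i)

namespace CGS

variable {Ag St : Type} {Ac : Ag → Type}

/-- The history `ρ(σ)[0 … t]` (as a list) together with the current state
`ρ(σ)[t]` of the run induced by a strategy profile `σ`. -/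
def histRun (M : CGS Ag St Ac) (σ : Profile St Ac) : ℕ → List St × St
  | 0 => ([M.init], M.init)
  | t + 1 =>
      let p := histRun M σ t
      let s := M.tr p.2 (fun i => σ i p.1)
      (p.1 ++ [s], s)

/-- The unique run `ρ(σ)` induced by a strategy profile `σ`. -/
def run (M : CGS Ag St Ac) (σ : Profile St Ac) (t : ℕ) : St :=
  (histRun M σ t).2

/-- A run of `M`: an infinite state sequence starting at the initial state in
which every step is obtained by some action profile. -/
def IsRun (M : CGS Ag St Ac) (ρ : ℕ → St) : Prop :=
  ρ 0 = M.init ∧ ∀ t, ∃ a : ∀ i, Ac i, ρ (t + 1) = M.tr (ρ t) a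

end CGS

open Classical in
/-- Combine a joint strategy `σC` for a coalition `C` with strategies `σN`
for the players outside `C`, obtaining a full strategy profile. -/
noncomputable def combine {Ag St : Type} {Ac : Ag → Type} (C : Set Ag)
    (σC : ∀ i ∈ C, Strategy St (Ac i)) (σN : ∀ i ∉ C, Strategy St (Ac i)) :
    Profile St Ac :=
  fun i => if h : i ∈ C then σC i h else σN i h

/-- Syntax of Linear Temporal Logic over atomic propositions `AP`:
atoms, negation, disjunction, next, and until. -/
inductive LTLFormula (AP : Type) where
  | atom : AP → LTLFormula AP
  | neg  : LTLFormula AP → LTLFormula AP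
  | disj : LTLFormula AP → LTLFormula AP → LTLFormula AP
  | next : LTLFormula AP → LTLFormula AP
  | untl : LTLFormula AP → LTLFormula AP → LTLFormula AP

/-- Standard LTL semantics over infinite runs `ρ : ℕ → St`, via a labelling
function `lab : St → Set AP`. -/
def LTLFormula.Sat {AP St : Type} (lab : St → Set AP) :
    LTLFormula AP → (ℕ → St) → Prop
  | .atom p, ρ => p ∈ lab (ρ 0)
  | .neg φ, ρ => ¬ LTLFormula.Sat lab φ ρ
  | .disj φ ψ, ρ => LTLFormula.Sat lab φ ρ ∨ LTLFormula.Sat lab ψ ρ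
  | .next φ, ρ => LTLFormula.Sat lab φ (fun t => ρ (t + 1))
  | .untl φ ψ, ρ =>
      ∃ j : ℕ, LTLFormula.Sat lab ψ (fun t => ρ (t + j)) ∧
        ∀ k < j, LTLFormula.Sat lab φ (fun t => ρ (t + k))

/-- An LTL game: a concurrent game structure together with a labelling
function and an LTL goal for each player. -/
structure LTLGame (Ag St : Type) (Ac : Ag → Type) (AP : Type) where
  M : CGS Ag St Ac
  lab : St → Set AP
  goal : Ag → LTLFormula AP

namespace LTLGame

variable {Ag St AP : Type} {Ac : Ag → Type}

/-- The winners of a run: players whose goal is satisfied by the run. -/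
def winners (G : LTLGame Ag St Ac AP) (ρ : ℕ → St) : Set Ag :=
  {i | (G.goal i).Sat G.lab ρ}

/-- `σC` is a beneficial deviation for the (nonempty) coalition `C` from the
strategy profile `σ`: every member of `C` loses under `σ`, and all members of
`C` win under `(σC, σN)` no matter which joint strategy `σN` the remaining
players use. -/
def BeneficialDeviation (G : LTLGame Ag St Ac AP) (C : Set Ag)
    (σ : Profile St Ac) (σC : ∀ i ∈ C, Strategy St (Ac i)) : Prop :=
  C.Nonempty ∧
  C ⊆ (G.winners (G.M.run σ))ᶜ ∧
  ∀ σN : ∀ i ∉ C, Strategy St (Ac i), C ⊆ G.winners (G.M.run (combine C σC σN))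

/-- A strategy profile is in the core iff no coalition has a beneficial
deviation from it. -/
def inCore (G : LTLGame Ag St Ac AP) (σ : Profile St Ac) : Prop :=
  ∀ (C : Set Ag) (σC : ∀ i ∈ C, Strategy St (Ac i)),
    ¬ G.BeneficialDeviation C σ σC

/-- A (nonempty) coalition `C` is fulfilled if it has a joint strategy
guaranteeing all goals of its members, against every joint strategy of the
remaining players. -/
def Fulfilled (G : LTLGame Ag St Ac AP) (C : Set Ag) : Prop :=
  C.Nonempty ∧
  ∃ σC : ∀ i ∈ C, Strategy St (Ac i),
    ∀ σN : ∀ i ∉ C, Strategy St (Ac i),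
      C ⊆ G.winners (G.M.run (combine C σC σN))

/-- `σC` is a strong beneficial deviation for the (nonempty) coalition `C`
from `σ`: (1) all members of `C` lose under `σ`; (2) all members of `C` win
under `(σ₋C, σC)`; (3) against every counter joint strategy `σN` under which
all original winners still win, all members of `C` win. -/
def StrongBeneficialDeviation (G : LTLGame Ag St Ac AP) (C : Set Ag)
    (σ : Profile St Ac) (σC : ∀ i ∈ C, Strategy St (Ac i)) : Prop :=
  C.Nonempty ∧
  C ⊆ (G.winners (G.M.run σ))ᶜ ∧
  C ⊆ G.winners (G.M.run (combine C σC (fun i _ => σ i))) ∧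
  ∀ σN : ∀ i ∉ C, Strategy St (Ac i),
    G.winners (G.M.run σ) ⊆ G.winners (G.M.run (combine C σC σN)) →
      C ⊆ G.winners (G.M.run (combine C σC σN))

/-- A strategy profile is in the strong core iff no coalition has a strong
beneficial deviation from it. -/
def inStrongCore (G : LTLGame Ag St Ac AP) (σ : Profile St Ac) : Prop :=
  ∀ (C : Set Ag) (σC : ∀ i ∈ C, Strategy St (Ac i)),
    ¬ G.StrongBeneficialDeviation C σ σC

/-- `(G, φ) ∈ E-Core` iff some member of the core of `G` induces a run
satisfying `φ`. -/
def ECore (G : LTLGame Ag St Ac AP) (φ : LTLFormula AP) : Prop :=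
  ∃ σ : Profile St Ac, G.inCore σ ∧ φ.Sat G.lab (G.M.run σ)

end LTLGame

namespace LTLGame

/-- A strong beneficial deviation by `C`, described through the profile `p` it leads to. -/
theorem StrongBeneficialDeviation.exists_profile {Ag St AP : Type} {Ac : Ag → Type}
    {G : LTLGame Ag St Ac AP} {C : Set Ag} {σ : Profile St Ac}
    {σC : ∀ i ∈ C, Strategy St (Ac i)} (h : G.StrongBeneficialDeviation C σ σC) :
    ∃ p : Profile St Ac, (∀ i (hi : i ∈ C), p i = σC i hi) ∧ (∀ i ∉ C, p i = σ i) ∧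
      (∀ i ∈ C, i ∈ G.winners (G.M.run p)) ∧
      ∀ q : Profile St Ac, (∀ i ∈ C, q i = p i) →
        G.winners (G.M.run σ) ⊆ G.winners (G.M.run q) → C ⊆ G.winners (G.M.run q) := by
  obtain ⟨-, -, hwin, hcounter⟩ := h
  refine ⟨combine C σC fun i _ => σ i, fun i hi => dif_pos hi, fun i hi => dif_neg hi,
    fun i hi => hwin hi, fun q hq => ?_⟩
  have hcombine : combine C σC (fun i _ => q i) = q := by
    funext i
    by_cases hi : i ∈ C
    · rw [hq i hi]
      simp [combine, hi]
    · simp [combine, hi]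
  simpa only [hcombine] using hcounter fun i _ => q i

/-- A strong beneficial deviation by a single player `x` constrains every profile in which `x`
uses the deviating strategy. -/
theorem StrongBeneficialDeviation.wins_of_singleton {Ag St AP : Type} {Ac : Ag → Type}
    {G : LTLGame Ag St Ac AP} {x : Ag} {σ p q : Profile St Ac}
    (h : G.StrongBeneficialDeviation {x} σ fun i _ => p i) (hq : q x = p x)
    (hsub : G.winners (G.M.run σ) ⊆ G.winners (G.M.run q)) : x ∈ G.winners (G.M.run q) := by
  obtain ⟨r, hr, -, -, hcounter⟩ := h.exists_profile
  refine hcounter q (fun i hi => ?_) hsub rfl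
  obtain rfl : i = x := hi
  rw [hq, hr i rfl]

section ThreePlayers

variable {St AP : Type} {Ac : Fin 3 → Type} {G : LTLGame (Fin 3) St Ac AP}

/-- If the strong core is empty, then no run satisfies all three goals. -/
theorem not_all_win_of_empty_strongCore
    (hempty : ∀ σ : Profile St Ac, ∃ (C : Set (Fin 3)) (σC : ∀ i ∈ C, Strategy St (Ac i)),
      G.StrongBeneficialDeviation C σ σC)
    {x y z : Fin 3} (hxyz : ∀ i, i = x ∨ i = y ∨ i = z) (σ : Profile St Ac)
    (hx : x ∈ G.winners (G.M.run σ)) (hy : y ∈ G.winners (G.M.run σ))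
    (hz : z ∈ G.winners (G.M.run σ)) : False := by
  obtain ⟨C, σC, ⟨i, hi⟩, hlose, -⟩ := hempty σ
  rcases hxyz i with rfl | rfl | rfl
  exacts [hlose hi hx, hlose hi hy, hlose hi hz]

/-- If the strong core is empty and only `x` and `y` win under `σ`, then `z` has a strong
beneficial deviation. -/
theorem exists_deviation_of_two_winners
    (hempty : ∀ σ : Profile St Ac, ∃ (C : Set (Fin 3)) (σC : ∀ i ∈ C, Strategy St (Ac i)),
      G.StrongBeneficialDeviation C σ σC)
    {x y z : Fin 3} (hxyz : ∀ i, i = x ∨ i = y ∨ i = z) {σ : Profile St Ac}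
    (hx : x ∈ G.winners (G.M.run σ)) (hy : y ∈ G.winners (G.M.run σ))
    (hz : z ∉ G.winners (G.M.run σ)) :
    ∃ p : Profile St Ac, p x = σ x ∧ p y = σ y ∧ z ∈ G.winners (G.M.run p) ∧
      ∀ q : Profile St Ac, q z = p z → x ∈ G.winners (G.M.run q) →
        y ∈ G.winners (G.M.run q) → z ∈ G.winners (G.M.run q) := by
  obtain ⟨C, σC, h⟩ := hempty σ
  obtain ⟨p, -, hout, hwin, hcounter⟩ := h.exists_profile
  obtain ⟨⟨i, hi⟩, hlose, -⟩ := h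
  have hxC : x ∉ C := fun h => hlose h hx
  have hyC : y ∉ C := fun h => hlose h hy
  have hzC : z ∈ C := by
    rcases hxyz i with rfl | rfl | rfl
    exacts [absurd hi hxC, absurd hi hyC, hi]
  refine ⟨p, hout x hxC, hout y hyC, hwin z hzC, fun q hq hqx hqy => ?_⟩
  refine hcounter q (fun j hj => ?_) (fun j hj => ?_) hzC
  · rcases hxyz j with rfl | rfl | rfl
    exacts [absurd hj hxC, absurd hj hyC, hq]
  · rcases hxyz j with rfl | rfl | rfl
    exacts [hqx, hqy, absurd hj hz]

/-- If the strong core is empty and only `x` wins under `σ`, then `y`, or `z`, or both together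
have a strong beneficial deviation. -/
theorem exists_deviation_of_one_winner
    (hempty : ∀ σ : Profile St Ac, ∃ (C : Set (Fin 3)) (σC : ∀ i ∈ C, Strategy St (Ac i)),
      G.StrongBeneficialDeviation C σ σC)
    {x y z : Fin 3} (hxyz : ∀ i, i = x ∨ i = y ∨ i = z) {σ : Profile St Ac}
    (hx : x ∈ G.winners (G.M.run σ)) (hy : y ∉ G.winners (G.M.run σ))
    (hz : z ∉ G.winners (G.M.run σ)) :
    ∃ p : Profile St Ac, p x = σ x ∧
      ((p z = σ z ∧ y ∈ G.winners (G.M.run p) ∧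
          ∀ q : Profile St Ac, q y = p y → x ∈ G.winners (G.M.run q) →
            y ∈ G.winners (G.M.run q)) ∨
        (p y = σ y ∧ z ∈ G.winners (G.M.run p) ∧
          ∀ q : Profile St Ac, q z = p z → x ∈ G.winners (G.M.run q) →
            z ∈ G.winners (G.M.run q)) ∨
        (y ∈ G.winners (G.M.run p) ∧ z ∈ G.winners (G.M.run p))) := by
  obtain ⟨C, σC, h⟩ := hempty σ
  obtain ⟨p, -, hout, hwin, hcounter⟩ := h.exists_profile
  obtain ⟨⟨i, hi⟩, hlose, -⟩ := h
  have hxC : x ∉ C := fun h => hlose h hx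
  have hsub : ∀ q : Profile St Ac, x ∈ G.winners (G.M.run q) →
      G.winners (G.M.run σ) ⊆ G.winners (G.M.run q) := by
    intro q hq j hj
    rcases hxyz j with rfl | rfl | rfl
    exacts [hq, absurd hj hy, absurd hj hz]
  refine ⟨p, hout x hxC, ?_⟩
  by_cases hyC : y ∈ C
  · by_cases hzC : z ∈ C
    · exact Or.inr (Or.inr ⟨hwin y hyC, hwin z hzC⟩)
    · refine Or.inl ⟨hout z hzC, hwin y hyC, fun q hq hqx =>
        hcounter q (fun j hj => ?_) (hsub q hqx) hyC⟩
      rcases hxyz j with rfl | rfl | rfl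
      exacts [absurd hj hxC, hq, absurd hj hzC]
  · have hzC : z ∈ C := by
      rcases hxyz i with rfl | rfl | rfl
      exacts [absurd hi hxC, absurd hi hyC, hi]
    refine Or.inr (Or.inl ⟨hout y hyC, hwin z hzC, fun q hq hqx =>
      hcounter q (fun j hj => ?_) (hsub q hqx) hzC⟩)
    rcases hxyz j with rfl | rfl | rfl
    exacts [absurd hj hxC, absurd hj hyC, hq]

end ThreePlayers

end LTLGame

/-- Let `G` be a three-player LTL game with empty strong core,
and `{a,b,c}` a permutation of the three players.  Then there are no profiles
`τ = (σ_a, σ_b, σ_c)`, `τ' = (σ_a, σ_b, σ'_c)`, `τ'' = (σ'_a, σ_b, σ'_c)`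
such that: `ρ(τ)` satisfies `γ_a` and `γ_b` but not `γ_c`; `ρ(τ')` satisfies
`γ_c` only; `ρ(τ'')` satisfies `γ_a` only; `σ'_c` is a strong beneficial
deviation for `{c}` from `τ`; and `σ'_a` is a strong beneficial deviation for
`{a}` from `τ'`. -/
theorem no_two_step_deviation_chain_of_empty_strongCore
    {St AP : Type} {Ac : Fin 3 → Type}
    [Fintype St] [∀ i, Fintype (Ac i)] [∀ i, Nonempty (Ac i)] [Fintype AP]
    (G : LTLGame (Fin 3) St Ac AP)
    (hempty : ∀ σ : Profile St Ac,
      ∃ (C : Set (Fin 3)) (σC : ∀ i ∈ C, Strategy St (Ac i)),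
        G.StrongBeneficialDeviation C σ σC)
    (a b c : Fin 3) (hab : a ≠ b) (hac : a ≠ c) (hbc : b ≠ c) :
    ¬ ∃ τ τ' τ'' : Profile St Ac,
        -- `τ' = (σ_a, σ_b, σ'_c)` differs from `τ = (σ_a, σ_b, σ_c)` only at `c`
        τ' a = τ a ∧ τ' b = τ b ∧
        -- `τ'' = (σ'_a, σ_b, σ'_c)` differs from `τ'` only at `a`
        τ'' b = τ' b ∧ τ'' c = τ' c ∧
        -- `ρ(τ)` satisfies `γ_a` and `γ_b` but not `γ_c`
        ((G.goal a).Sat G.lab (G.M.run τ) ∧ (G.goal b).Sat G.lab (G.M.run τ) ∧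
          ¬ (G.goal c).Sat G.lab (G.M.run τ)) ∧
        -- `ρ(τ')` satisfies `γ_c` only
        ((G.goal c).Sat G.lab (G.M.run τ') ∧ ¬ (G.goal a).Sat G.lab (G.M.run τ') ∧
          ¬ (G.goal b).Sat G.lab (G.M.run τ')) ∧
        -- `ρ(τ'')` satisfies `γ_a` only
        ((G.goal a).Sat G.lab (G.M.run τ'') ∧ ¬ (G.goal b).Sat G.lab (G.M.run τ'') ∧
          ¬ (G.goal c).Sat G.lab (G.M.run τ'')) ∧
        -- `σ'_c` is a strong beneficial deviation for `{c}` from `τ`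
        G.StrongBeneficialDeviation {c} τ (fun i _ => τ' i) ∧
        -- `σ'_a` is a strong beneficial deviation for `{a}` from `τ'`
        G.StrongBeneficialDeviation {a} τ' (fun i _ => τ'' i) := by
  have hperm : ∀ a b c : Fin 3, a ≠ b → a ≠ c → b ≠ c → ∀ i, i = a ∨ i = b ∨ i = c := by
    decide
  rintro ⟨τ, τ', τ'', -, -, -, hc'', ⟨-, -, hτc⟩, ⟨-, hτa', hτb'⟩, ⟨ha, hb, hc⟩, hdevc, hdeva⟩
  have habc := hperm a b c hab hac hbc
  have hbac := hperm b a c hab.symm hbc hac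
  have hacb := hperm a c b hac hab hbc.symm
  have hall := LTLGame.not_all_win_of_empty_strongCore hempty habc
  have hnot_ab : ∀ q : Profile St Ac, q c = τ' c → a ∈ G.winners (G.M.run q) →
      b ∈ G.winners (G.M.run q) → False := by
    intro q hq hqa hqb
    refine hall q hqa hqb (hdevc.wins_of_singleton hq fun j hj => ?_)
    rcases habc j with rfl | rfl | rfl
    exacts [hqa, hqb, absurd hj hτc]
  have hca : ∀ q : Profile St Ac, q a = τ'' a → c ∈ G.winners (G.M.run q) →
      a ∈ G.winners (G.M.run q) := by
    intro q hq hqc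
    refine hdeva.wins_of_singleton hq fun j hj => ?_
    rcases habc j with rfl | rfl | rfl
    exacts [absurd hj hτa', absurd hj hτb', hqc]
  obtain ⟨p, hpa, ⟨hpc, hpb, hp⟩ | ⟨hpb, hpc, hp⟩ | ⟨hpb, hpc⟩⟩ :=
    LTLGame.exists_deviation_of_one_winner hempty habc ha hb hc
  · -- `b` deviates alone from `τ''`
    have hpa' : a ∉ G.winners (G.M.run p) := fun h => hnot_ab p (hpc.trans hc'') h hpb
    have hpc' : c ∉ G.winners (G.M.run p) := fun h => hpa' (hca p hpa h)
    obtain ⟨r, hrb, ⟨hrc, hra, -⟩ | ⟨hra, hrc, -⟩ | ⟨hra, hrc⟩⟩ :=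
      LTLGame.exists_deviation_of_one_winner hempty hbac hpb hpa' hpc'
    · exact hnot_ab r (hrc.trans (hpc.trans hc'')) hra (hp r hrb hra)
    · have hra' := hca r (hra.trans hpa) hrc
      exact hall r hra' (hp r hrb hra') hrc
    · exact hall r hra (hp r hrb hra) hrc
  · -- `c` deviates alone from `τ''`, and then `b` must deviate
    have hpa' := hca p hpa hpc
    obtain ⟨s, hsa, hsc, hsb, hs⟩ := LTLGame.exists_deviation_of_two_winners hempty hacb
      hpa' hpc (fun h => hall p hpa' h hpc)
    have hnot_ac : ∀ q : Profile St Ac, q b = s b → a ∈ G.winners (G.M.run q) →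
        c ∈ G.winners (G.M.run q) → False := fun q hq hqa hqc =>
      hall q hqa (hs q hq hqa hqc) hqc
    have hsa' : a ∉ G.winners (G.M.run s) := fun h => hnot_ac s rfl h (hp s hsc h)
    have hsc' : c ∉ G.winners (G.M.run s) := fun h => hsa' (hca s (hsa.trans hpa) h)
    obtain ⟨r, hrb, ⟨hrc, hra, -⟩ | ⟨hra, hrc, -⟩ | ⟨hra, hrc⟩⟩ :=
      LTLGame.exists_deviation_of_one_winner hempty hbac hsb hsa' hsc'
    · exact hnot_ac r hrb hra (hp r (hrc.trans hsc) hra)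
    · exact hnot_ac r hrb (hca r (hra.trans (hsa.trans hpa)) hrc) hrc
    · exact hnot_ac r hrb hra hrc
  · exact hall p (hca p hpa hpc) hpb hpc
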